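/- arXiv:2603.29905 — 6 statements merged into one kernel-verified Lean document; each statement's English description precedes it below -/
import Mathlib

section
/- Let p be a prime number and let χ : ℤ_p → ℚ_p^× be an injective p-adic character on ℤ_p. For any natural numbers n and m, any continuous map f : ℤ_p^n → ℚ_p^m, and any real ε > 0, there exist a natural number d, a matrix A ∈ M_{d×n}(ℤ_p), a vector b ∈ ℤ_p^d, and a matrix C ∈ M_{m×d}(ℚ_p) such that for every x ∈ ℤ_p^n one has ‖f(x) − C·χ(Ax + b)‖ < ε, where χ is applied entrywise to the vector Ax + b ∈ ℤ_p^d and ‖·‖ denotes the ℓ^∞-norm (maximum of the p-adic absolute values of the entries) on ℚ_p^m. -/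
open Set Topology

/-- The scalar action of `ℤ_[p]` on `ℚ_[p]` is bounded. -/
instance PadicInt.isBoundedSMul_padic (p : ℕ) [Fact p.Prime] : IsBoundedSMul ℤ_[p] ℚ_[p] :=
  .of_norm_smul_le fun r x => by
    rw [Algebra.smul_def, norm_mul]
    rfl

/-- A Mahler basis function composed with an element of a subalgebra lies in that subalgebra. -/
theorem Subalgebra.mahlerTerm_comp_mem {p : ℕ} [Fact p.Prime] {X : Type*} [TopologicalSpace X]
    (B : Subalgebra ℚ_[p] C(X, ℚ_[p])) (h : C(X, ℤ_[p]))
    (hB : (⟨fun x => (h x : ℚ_[p]), by fun_prop⟩ : C(X, ℚ_[p])) ∈ B) (a : ℚ_[p]) (k : ℕ) :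
    (PadicInt.mahlerTerm a k : C(ℤ_[p], ℚ_[p])).comp h ∈ B := by
  set H : C(X, ℚ_[p]) := ⟨fun x => (h x : ℚ_[p]), by fun_prop⟩
  have key : (PadicInt.mahlerTerm a k : C(ℤ_[p], ℚ_[p])).comp h =
      (a * (k.factorial : ℚ_[p])⁻¹) • Polynomial.aeval H (descPochhammer ℚ_[p] k) := by
    ext x
    have h1 : ((Ring.choose (h x) k : ℤ_[p]) : ℚ_[p]) =
        (k.factorial : ℚ_[p])⁻¹ * (descPochhammer ℚ_[p] k).eval (h x : ℚ_[p]) := by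
      have := Ring.map_choose (PadicInt.Coe.ringHom (p := p)) (h x) k
      rw [Ring.choose_eq_smul, ← Polynomial.aeval_eq_smeval, Polynomial.aeval_def] at this
      rw [← descPochhammer_map (Int.castRingHom ℚ_[p]), Polynomial.eval_map]
      exact this
    have h2 : (Polynomial.aeval H (descPochhammer ℚ_[p] k)) x =
        (descPochhammer ℚ_[p] k).eval (h x : ℚ_[p]) := by
      have := Polynomial.aeval_algHom_apply (ContinuousMap.evalAlgHom ℚ_[p] ℚ_[p] x) H
        (descPochhammer ℚ_[p] k)
      simpa [Polynomial.aeval_def, Polynomial.eval₂_eq_eval_map, H] using this.symm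
    rw [ContinuousMap.comp_apply, PadicInt.mahlerTerm_apply, ContinuousMap.smul_apply, h2, mahler_apply,
      Algebra.smul_def, smul_eq_mul]
    change ((Ring.choose (h x) k : ℤ_[p]) : ℚ_[p]) * a = _
    rw [h1]
    ring
  rw [key]
  exact B.smul_mem (Polynomial.aeval_mem_adjoin_singleton _ _ |> Algebra.adjoin_le (by simpa)) _

/-- Closed subalgebras of `C(X, ℚ_[p])` are stable under continuous functional calculus for
functions bounded by `1`. -/
theorem Subalgebra.comp_mem_of_isClosed {p : ℕ} [Fact p.Prime] {X : Type*} [TopologicalSpace X]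
    (B : Subalgebra ℚ_[p] C(X, ℚ_[p])) (hcl : IsClosed (B : Set C(X, ℚ_[p]))) (h : C(X, ℤ_[p]))
    (hB : (⟨fun x => (h x : ℚ_[p]), by fun_prop⟩ : C(X, ℚ_[p])) ∈ B) (φ : C(ℤ_[p], ℚ_[p])) :
    φ.comp h ∈ B := by
  have hs := (PadicInt.hasSum_mahler φ).map (ContinuousMap.compRightAlgHom ℚ_[p] ℚ_[p] h)
    (ContinuousMap.continuous_precomp h)
  exact hcl.mem_of_tendsto hs
    (.of_forall fun s => B.sum_mem fun k _ => B.mahlerTerm_comp_mem h hB _ k)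

/-- Every bounded function is a scalar multiple of a function with values in `ℤ_[p]`. -/
theorem ContinuousMap.exists_smul_eq_coe {p : ℕ} [Fact p.Prime] {X : Type*} [TopologicalSpace X]
    [CompactSpace X] (g : C(X, ℚ_[p])) :
    ∃ c : ℚ_[p], c ≠ 0 ∧ ∃ h : C(X, ℤ_[p]), ∀ x, (h x : ℚ_[p]) = c * g x := by
  obtain ⟨N, hN⟩ := pow_unbounded_of_one_lt ‖g‖
    (show (1 : ℝ) < p from mod_cast (Fact.out : p.Prime).one_lt)
  have hp0 : (p : ℚ_[p]) ≠ 0 := mod_cast (Fact.out : p.Prime).ne_zero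
  have hpp : (0 : ℝ) < p := mod_cast (Fact.out : p.Prime).pos
  have hle (x : X) : ‖(p : ℚ_[p]) ^ N * g x‖ ≤ 1 := by
    rw [norm_mul, norm_pow, Padic.norm_p, inv_pow, inv_mul_le_iff₀ (by positivity), mul_one]
    exact (g.norm_coe_le_norm x).trans hN.le
  exact ⟨p ^ N, pow_ne_zero _ hp0, ⟨fun x => ⟨p ^ N * g x, hle x⟩, by fun_prop⟩, fun x => rfl⟩

/-- A closed subalgebra of `C(X, ℚ_[p])` that separates points contains the indicators of some
clopen sets separating any two given points. -/
theorem Subalgebra.exists_isClopen_indicator_mem {p : ℕ} [Fact p.Prime] {X : Type*}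
    [TopologicalSpace X] [CompactSpace X] (B : Subalgebra ℚ_[p] C(X, ℚ_[p]))
    (hcl : IsClosed (B : Set C(X, ℚ_[p]))) (hsep : B.SeparatesPoints) {x y : X} (hxy : x ≠ y) :
    ∃ V : Set X, IsClopen V ∧ x ∈ V ∧ y ∉ V ∧ ∃ g ∈ B, ⇑g = V.indicator 1 := by
  obtain ⟨_, ⟨g, hg, rfl⟩, hgxy⟩ := hsep hxy
  obtain ⟨c, hc, h, hh⟩ := g.exists_smul_eq_coe
  have hne : h x ≠ h y := fun e => hgxy (mul_left_cancel₀ hc (by rw [← hh, ← hh, e]))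
  have hW : IsClopen (Metric.ball (h x) (dist (h y) (h x))) := IsUltrametricDist.isClopen_ball _ _
  refine ⟨h ⁻¹' Metric.ball (h x) (dist (h y) (h x)), hW.preimage h.continuous, ?_, ?_,
    (LocallyConstant.charFn ℚ_[p] hW : C(ℤ_[p], ℚ_[p])).comp h,
    B.comp_mem_of_isClosed hcl h ?_ _, ?_⟩
  · simpa using hne.symm
  · simp
  · convert B.smul_mem hg c using 1
    ext x
    simp [hh]
  · ext z
    simp [LocallyConstant.coe_charFn, indicator]

/-- A closed subalgebra of `C(X, ℚ_[p])` that separates points contains the indicators of all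
clopen sets. -/
theorem Subalgebra.indicator_mem_of_isClopen {p : ℕ} [Fact p.Prime] {X : Type*}
    [TopologicalSpace X] [CompactSpace X] (B : Subalgebra ℚ_[p] C(X, ℚ_[p]))
    (hcl : IsClosed (B : Set C(X, ℚ_[p]))) (hsep : B.SeparatesPoints) {U : Set X}
    (hU : IsClopen U) : ∃ g ∈ B, ⇑g = U.indicator 1 := by
  have hnhd : ∀ x ∈ U, ∃ V : Set X, IsClopen V ∧ x ∈ V ∧ V ⊆ U ∧ ∃ g ∈ B, ⇑g = V.indicator 1 := by
    intro x hx
    obtain ⟨V, hV, hxV, hVU, hg⟩ : ∃ V : Set X, IsClopen V ∧ x ∈ V ∧ Disjoint V Uᶜ ∧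
        ∃ g ∈ B, ⇑g = V.indicator 1 := by
      refine hU.compl.isClosed.isCompact.induction_on ?_ ?_ ?_ ?_
      · exact ⟨univ, isClopen_univ, mem_univ x, disjoint_empty _, 1, B.one_mem, by simp⟩
      · rintro s t hst ⟨V, hV, hxV, hVt, hg⟩
        exact ⟨V, hV, hxV, hVt.mono_right hst, hg⟩
      · rintro s t ⟨V, hV, hxV, hVs, g, hg, hgV⟩ ⟨W, hW, hxW, hWt, k, hk, hkW⟩
        refine ⟨V ∩ W, hV.inter hW, ⟨hxV, hxW⟩, disjoint_union_right.2
          ⟨hVs.mono_left inter_subset_left, hWt.mono_left inter_subset_right⟩,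
          g * k, B.mul_mem hg hk, ?_⟩
        rw [ContinuousMap.coe_mul, hgV, hkW, inter_indicator_one]
      · intro y hy
        obtain ⟨V, hV, hxV, hyV, hg⟩ := B.exists_isClopen_indicator_mem hcl hsep
          (show x ≠ y from fun e => hy (e ▸ hx))
        exact ⟨Vᶜ, mem_nhdsWithin_of_mem_nhds (hV.compl.isOpen.mem_nhds hyV), V, hV, hxV,
          disjoint_compl_right, hg⟩
    exact ⟨V, hV, hxV, disjoint_compl_right_iff_subset.1 hVU, hg⟩
  obtain ⟨V, hUV, hVU, hg⟩ : ∃ V : Set X, U ⊆ V ∧ V ⊆ U ∧ ∃ g ∈ B, ⇑g = V.indicator 1 := by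
    refine hU.isClosed.isCompact.induction_on (p := fun s => ∃ V : Set X, s ⊆ V ∧ V ⊆ U ∧
      ∃ g ∈ B, ⇑g = V.indicator 1) ?_ ?_ ?_ ?_
    · exact ⟨∅, Subset.rfl, empty_subset _, 0, B.zero_mem, by simp; rfl⟩
    · rintro s t hst ⟨V, htV, h⟩
      exact ⟨V, hst.trans htV, h⟩
    · rintro s t ⟨V, hsV, hVU, g, hg, hgV⟩ ⟨W, htW, hWU, k, hk, hkW⟩
      refine ⟨V ∪ W, union_subset_union hsV htW, union_subset hVU hWU, g + k - g * k,
        B.sub_mem (B.add_mem hg hk) (B.mul_mem hg hk), ?_⟩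
      ext z
      by_cases hz : z ∈ V <;> by_cases hz' : z ∈ W <;> simp [hgV, hkW, hz, hz']
    · intro x hx
      obtain ⟨V, hV, hxV, hVU, hg⟩ := hnhd x hx
      exact ⟨V, mem_nhdsWithin_of_mem_nhds (hV.isOpen.mem_nhds hxV), V, Subset.rfl, hVU, hg⟩
  rwa [hUV.antisymm hVU]

/-- The **`p`-adic Stone-Weierstrass theorem** (Dieudonné): a subalgebra of `C(X, ℚ_[p])` that
separates points is dense. -/
theorem Subalgebra.topologicalClosure_eq_top_of_separatesPoints_padic {p : ℕ} [Fact p.Prime]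
    {X : Type*} [TopologicalSpace X] [CompactSpace X] [T2Space X] [TotallyDisconnectedSpace X]
    (A : Subalgebra ℚ_[p] C(X, ℚ_[p])) (hsep : A.SeparatesPoints) :
    A.topologicalClosure = ⊤ := by
  have hcl := A.isClosed_topologicalClosure
  have hsep' : A.topologicalClosure.SeparatesPoints :=
    Subalgebra.separatesPoints_monotone A.le_topologicalClosure hsep
  refine eq_top_iff.2 fun f _ => ?_
  suffices f ∈ closure (A.topologicalClosure : Set C(X, ℚ_[p])) by rwa [hcl.closure_eq] at this
  refine Metric.mem_closure_iff.2 fun ε hε => ?_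
  have hS : {q : ℚ_[p] × ℚ_[p] | dist q.1 q.2 < ε} ∈ 𝓝ˢ (diagonal ℚ_[p]) :=
    (isOpen_lt (by fun_prop) (by fun_prop)).mem_nhdsSet.2 (by rintro ⟨a, b⟩ (rfl : a = b); simpa)
  obtain ⟨n, U, v, hUv⟩ :=
    f.exists_finite_sum_const_indicator_approximation_of_mem_nhds_diagonal hS
  choose g hg hgU using fun i =>
    A.topologicalClosure.indicator_mem_of_isClopen hcl hsep' (U i).isClopen
  refine ⟨∑ i, v i • g i, sum_mem fun i _ => Subalgebra.smul_mem _ (hg i) _, ?_⟩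
  refine (ContinuousMap.dist_lt_iff hε).2 fun x => ?_
  convert hUv x using 2
  simp [ContinuousMap.sum_apply, hgU, indicator]

/-- The functions `x ↦ χ (a ⬝ᵥ x)`, as a monoid homomorphism in `a`. -/
noncomputable def charDotProductHom {p : ℕ} [Fact p.Prime] (χ : ℤ_[p] → ℚ_[p]ˣ)
    (hχ_cont : Continuous fun x : ℤ_[p] => (χ x : ℚ_[p]))
    (hχ_hom : ∀ x y : ℤ_[p], χ (x + y) = χ x * χ y) (n : ℕ) :
    Multiplicative (Fin n → ℤ_[p]) →* C(Fin n → ℤ_[p], ℚ_[p]) where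
  toFun a := ⟨fun x => χ (a.toAdd ⬝ᵥ x), hχ_cont.comp (by unfold dotProduct; fun_prop)⟩
  map_one' := by
    ext x
    have : χ 0 = 1 := by simpa using hχ_hom 0 0
    simp [this]
  map_mul' a b := by
    ext x
    simp [add_dotProduct, hχ_hom]

/-- **Universal approximation theorem for a `p`-adic character.**
Let `p` be a prime and `χ : ℤ_p → ℚ_p^×` an injective `p`-adic character (a continuous
group homomorphism from the additive group `ℤ_p` to `ℚ_p^×`).  For all `n m : ℕ`, every
continuous `f : ℤ_p^n → ℚ_p^m` and every `ε > 0`, there are `d : ℕ`,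
`A ∈ M_{d×n}(ℤ_p)`, `b ∈ ℤ_p^d` and `C ∈ M_{m×d}(ℚ_p)` with
`‖f x - C·χ(Ax + b)‖ < ε` for all `x ∈ ℤ_p^n`, `χ` applied entrywise and `‖·‖` the
`ℓ^∞`-norm (the sup-norm of the `Pi` type). -/
theorem padic_character_universal_approximation
    (p : ℕ) [Fact p.Prime] (χ : ℤ_[p] → ℚ_[p]ˣ)
    (hχ_cont : Continuous fun x : ℤ_[p] => (χ x : ℚ_[p]))
    (hχ_hom : ∀ x y : ℤ_[p], χ (x + y) = χ x * χ y)
    (hχ_inj : Function.Injective χ)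
    (n m : ℕ) (f : (Fin n → ℤ_[p]) → (Fin m → ℚ_[p])) (hf : Continuous f)
    (ε : ℝ) (hε : 0 < ε) :
    ∃ (d : ℕ) (A : Matrix (Fin d) (Fin n) ℤ_[p]) (b : Fin d → ℤ_[p])
      (C : Matrix (Fin m) (Fin d) ℚ_[p]),
      ∀ x : Fin n → ℤ_[p],
        ‖f x - C.mulVec (fun i => (χ ((A.mulVec x + b) i) : ℚ_[p]))‖ < ε := by
  classical
  set Φ := charDotProductHom χ hχ_cont hχ_hom n with hΦ
  set A : Subalgebra ℚ_[p] C(Fin n → ℤ_[p], ℚ_[p]) := Algebra.adjoin ℚ_[p] (range Φ)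
  have hsep : A.SeparatesPoints := by
    intro x y hxy
    obtain ⟨i, hi⟩ := Function.ne_iff.1 hxy
    refine ⟨_, ⟨Φ (.ofAdd (Pi.single i 1)), Algebra.subset_adjoin (mem_range_self _), rfl⟩, ?_⟩
    simpa [hΦ, charDotProductHom, Units.val_inj] using hχ_inj.ne hi
  have happ (j : Fin m) : ∃ c : Multiplicative (Fin n → ℤ_[p]) →₀ ℚ_[p],
      ∀ x, ‖f x j - c.sum (fun a r => r * Φ a x)‖ < ε := by
    let F : C(Fin n → ℤ_[p], ℚ_[p]) := ⟨fun x => f x j, by fun_prop⟩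
    have hF : F ∈ A.topologicalClosure := by
      rw [A.topologicalClosure_eq_top_of_separatesPoints_padic hsep]
      trivial
    obtain ⟨g, hg, hFg⟩ := Metric.mem_closure_iff.1 hF ε hε
    have hg' : g ∈ Submodule.span ℚ_[p] (range Φ) := by
      have h : g ∈ Subalgebra.toSubmodule A := hg
      rwa [Algebra.adjoin_eq_span, ← MonoidHom.coe_mrange, Submonoid.closure_eq] at h
    obtain ⟨c, rfl⟩ := Finsupp.mem_span_range_iff_exists_finsupp.1 hg'
    refine ⟨c, fun x => ?_⟩
    have := (ContinuousMap.dist_lt_iff hε).1 hFg x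
    simpa [dist_eq_norm, F, Finsupp.sum, ContinuousMap.sum_apply] using this
  choose c hc using happ
  let S : Finset (Multiplicative (Fin n → ℤ_[p])) := Finset.univ.biUnion fun j => (c j).support
  refine ⟨S.card, fun i => (S.equivFin.symm i).1.toAdd, 0, fun j i => c j (S.equivFin.symm i).1,
    fun x => (pi_norm_lt_iff hε).2 fun j => ?_⟩
  have h := hc j x
  rw [Finsupp.sum_of_support_subset (s := S) _
    (Finset.subset_biUnion_of_mem (fun j => (c j).support) (Finset.mem_univ j)) _ (by simp),
    ← Finset.sum_coe_sort S, ← S.equivFin.symm.sum_comp] at h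
  simp only [add_zero]
  exact h
end

section
/- Let p be a prime number and let χ : ℤ_p → ℚ_p^× be a p-adic character on ℤ_p. Then χ is injective if and only if χ(1) ≠ 1 and χ(1) ≠ −1; equivalently, χ is injective if and only if χ is neither the trivial character (constant with value 1) nor, in the case p = 2, the unique continuous character with χ(1) = −1. -/
namespace PadicInt

/-- For odd `p`, the ring `ℤ_[p]` has no nontrivial `p`-th roots of unity. -/
theorem eq_one_of_pow_prime_eq_one {p : ℕ} [Fact p.Prime] (hodd : Odd p) {z : ℤ_[p]}
    (hz : z ^ p = 1) : z = 1 := by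
  have hdvd : (p : ℤ_[p]) ∣ z - 1 := by
    rw [← Ideal.mem_span_singleton, ← maximalIdeal_eq_span_p, ← ker_toZMod, RingHom.mem_ker,
      map_sub, map_one, ← ZMod.pow_card (toZMod z), ← map_pow, hz, map_one, sub_self]
  have hndvd : ¬ (p : ℤ_[p]) ∣ z := fun h =>
    prime_p.not_isUnit (isUnit_of_dvd_one ((dvd_sub_right h).1 hdvd))
  have hmul := emultiplicity_geom_sum₂_eq_one prime_p hodd hdvd hndvd
  by_contra hne
  have hsum := (Commute.all z 1).geom_sum₂_mul p
  rw [hz, one_pow, sub_self, mul_eq_zero, or_iff_left (sub_ne_zero.2 hne)] at hsum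
  rw [hsum, emultiplicity_zero] at hmul
  exact ENat.top_ne_one hmul

/-- `-1` is not a square in `ℤ_[2]`. -/
theorem two_sq_ne_neg_one (z : ℤ_[2]) : z ^ 2 ≠ -1 := fun h => by
  have hmod := congrArg (toZModPow (p := 2) 2) h
  rw [map_pow, map_neg, map_one] at hmod
  generalize toZModPow (p := 2) 2 z = w at hmod
  revert w
  decide

/-- The only roots of unity of `p`-power order in `ℤ_[p]` are `1` and `-1`. -/
theorem eq_one_or_eq_neg_one_of_pow_prime_pow_eq_one {p : ℕ} [hp : Fact p.Prime] {z : ℤ_[p]}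
    {n : ℕ} (hz : z ^ p ^ n = 1) : z = 1 ∨ z = -1 := by
  rcases hp.out.eq_two_or_odd' with rfl | hodd
  · induction n generalizing z with
    | zero => left; simpa using hz
    | succ n ih =>
      rw [pow_succ', pow_mul] at hz
      exact sq_eq_one_iff.1 ((ih hz).resolve_right (two_sq_ne_neg_one z))
  · left
    induction n with
    | zero => simpa using hz
    | succ n ih =>
      rw [pow_succ, pow_mul] at hz
      exact ih (eq_one_of_pow_prime_eq_one hodd hz)

end PadicInt

/-- The only roots of unity of `p`-power order in `ℚ_[p]` are `1` and `-1`. -/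
theorem Padic.eq_one_or_eq_neg_one_of_pow_prime_pow_eq_one {p : ℕ} [hp : Fact p.Prime]
    {z : ℚ_[p]} {n : ℕ} (hz : z ^ p ^ n = 1) : z = 1 ∨ z = -1 := by
  have hnorm : ‖z‖ ≤ 1 :=
    (isOfFinOrder_iff_pow_eq_one.2 ⟨p ^ n, pow_pos hp.out.pos n, hz⟩).norm_eq_one.le
  obtain ⟨z, rfl⟩ : ∃ w : ℤ_[p], (w : ℚ_[p]) = z := ⟨⟨z, hnorm⟩, rfl⟩
  have hz' : z ^ p ^ n = 1 := PadicInt.ext (by simpa using hz)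
  exact (PadicInt.eq_one_or_eq_neg_one_of_pow_prime_pow_eq_one hz').imp
    (fun h => by simp [h]) (fun h => by simp [h])

/-- The kernel of a continuous additive character on `ℤ_[p]` is stable under multiplication by
`ℤ_[p]`. -/
theorem PadicInt.addChar_mul_eq_one {p : ℕ} [Fact p.Prime] {M : Type*} [Monoid M]
    [TopologicalSpace M] [T2Space M] {ψ : AddChar ℤ_[p] M} (hψ : Continuous ψ) {a : ℤ_[p]}
    (ha : ψ a = 1) (c : ℤ_[p]) : ψ (c * a) = 1 := by
  have h : (fun c => ψ (c * a)) = fun _ => 1 := by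
    refine denseRange_natCast.equalizer (by fun_prop) continuous_const (funext fun n => ?_)
    simp [← nsmul_eq_mul, ψ.map_nsmul_eq_pow, ha]
  exact congrFun h c

/-- A continuous character `ℤ_[p] → ℚ_[p]` is injective if and only if its value at `1` is
neither `1` nor `-1`. -/
theorem PadicInt.addChar_injective_iff {p : ℕ} [Fact p.Prime] {ψ : AddChar ℤ_[p] ℚ_[p]}
    (hψ : Continuous ψ) : Function.Injective ψ ↔ ψ 1 ≠ 1 ∧ ψ 1 ≠ -1 := by
  have hψ_nat (n : ℕ) : ψ n = ψ 1 ^ n := by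
    rw [← ψ.map_nsmul_eq_pow, nsmul_one]
  rw [AddChar.injective_iff]
  constructor
  · refine fun hinj => ⟨fun h => one_ne_zero (hinj h), fun h => two_ne_zero (hinj ?_)⟩
    simpa [h] using hψ_nat 2
  · rintro ⟨h1, h2⟩ a ha
    by_contra hne
    have hpow := addChar_mul_eq_one hψ ha ((unitCoeff hne)⁻¹ : ℤ_[p]ˣ)
    nth_rewrite 2 [unitCoeff_spec hne] at hpow
    rw [Units.inv_mul_cancel_left, ← Nat.cast_pow, hψ_nat] at hpow
    exact (Padic.eq_one_or_eq_neg_one_of_pow_prime_pow_eq_one hpow).elim h1 h2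


/-- Let `p` be a prime and `χ : ℤ_p → ℚ_p^×` a `p`-adic character on `ℤ_p` (a continuous
group homomorphism from the additive group `ℤ_p` to `ℚ_p^×`).  Then `χ` is injective if
and only if `χ(1) ≠ 1` and `χ(1) ≠ −1`; since a continuous character on `ℤ_p` is
determined by its value at `1`, this says exactly that `χ` is neither the trivial
character nor (in the case `p = 2`) the unique continuous character with `χ(1) = −1`. -/
theorem padic_character_injective_iff
    (p : ℕ) [Fact p.Prime] (χ : ℤ_[p] → ℚ_[p]ˣ)
    (hχ_cont : Continuous fun x : ℤ_[p] => (χ x : ℚ_[p]))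
    (hχ_hom : ∀ x y : ℤ_[p], χ (x + y) = χ x * χ y) :
    Function.Injective χ ↔ ((χ 1 : ℚ_[p]) ≠ 1 ∧ (χ 1 : ℚ_[p]) ≠ -1) := by
  let ψ : AddChar ℤ_[p] ℚ_[p] :=
    { toFun := fun x => χ x
      map_zero_eq_one' := by simpa using hχ_hom 0 0
      map_add_eq_mul' := fun x y => by simp [hχ_hom] }
  rw [← Units.val_injective.of_comp_iff χ]
  exact PadicInt.addChar_injective_iff (ψ := ψ) hχ_cont
end

section
/- Let p be a prime number and let a ∈ 1 + pℤ_p. For every x ∈ ℤ_p, the series Σ_{e=0}^{∞} C(x,e)·(a−1)^e converges in ℚ_p, where C(x,e) = (e!)^{-1} ∏_{i=0}^{e-1} (x−i) is the binomial coefficient function; denote its sum by a^x. Then a^x ∈ 1 + pℤ_p for every x ∈ ℤ_p, the map x ↦ a^x is continuous on ℤ_p, and for every natural number n, a^n as defined by this series equals the ordinary n-th power of a. -/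
/-- The binomial coefficient function `C(x,e) = (e!)⁻¹ ∏_{i=0}^{e-1} (x − i)` of a
`p`-adic integer `x`, with value in `ℚ_p`. -/
noncomputable def padicBinom (p : ℕ) [Fact p.Prime] (x : ℤ_[p]) (e : ℕ) : ℚ_[p] :=
  (∏ i ∈ Finset.range e, ((x : ℚ_[p]) - (i : ℚ_[p]))) / (e.factorial : ℚ_[p])

theorem padicBinom_eq_mahler (p : ℕ) [Fact p.Prime] (x : ℤ_[p]) (e : ℕ) :
    padicBinom p x e = ((mahler e x : ℤ_[p]) : ℚ_[p]) := by
  have hprod : (descPochhammer ℤ e).smeval x = ∏ i ∈ Finset.range e, (x - (i : ℤ_[p])) := by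
    induction e with
    | zero => simp
    | succ e ih =>
      rw [descPochhammer_succ_right, Polynomial.smeval_mul, ih, Finset.prod_range_succ,
        Polynomial.smeval_sub, Polynomial.smeval_X, Polynomial.smeval_natCast]
      simp
  have h := congrArg (fun y : ℤ_[p] => (y : ℚ_[p]))
    (hprod.symm.trans (Ring.descPochhammer_eq_factorial_smul_choose x e))
  have hcoe : ((∏ i ∈ Finset.range e, (x - (i : ℤ_[p])) : ℤ_[p]) : ℚ_[p]) =
      ∏ i ∈ Finset.range e, ((x : ℚ_[p]) - (i : ℚ_[p])) := by
    refine (map_prod (PadicInt.Coe.ringHom (p := p)) _ _).trans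
      (Finset.prod_congr rfl fun i _ => ?_)
    rw [map_sub, map_natCast]
    rfl
  have he : (e.factorial : ℚ_[p]) ≠ 0 := mod_cast e.factorial_ne_zero
  rw [padicBinom, ← hcoe, div_eq_iff he, mahler_apply, mul_comm]
  simpa [nsmul_eq_mul] using h

instance PadicInt.isBoundedSMulPadic (p : ℕ) [Fact p.Prime] : IsBoundedSMul ℤ_[p] ℚ_[p] :=
  .of_norm_smul_le fun r x => (norm_mul (r : ℚ_[p]) x).le

/-- Let `p` be a prime and `a ∈ 1 + pℤ_p`.  For every `x ∈ ℤ_p` the Mahler series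
`Σ_{e=0}^{∞} C(x,e)·(a−1)^e` converges in `ℚ_p`; writing `a^x` for its sum, one has
`a^x ∈ 1 + pℤ_p` for every `x ∈ ℤ_p`, the map `x ↦ a^x` is continuous on `ℤ_p`, and for
every natural number `n` the sum `a^n` equals the ordinary `n`-th power of `a`. -/
theorem padic_binomial_series
    (p : ℕ) [Fact p.Prime] (a : ℚ_[p]) (ha : ‖a - 1‖ ≤ (p : ℝ)⁻¹) :
    (∀ x : ℤ_[p], Summable fun e : ℕ => padicBinom p x e * (a - 1) ^ e) ∧
    (∀ x : ℤ_[p], ‖(∑' e : ℕ, padicBinom p x e * (a - 1) ^ e) - 1‖ ≤ (p : ℝ)⁻¹) ∧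
    Continuous (fun x : ℤ_[p] => ∑' e : ℕ, padicBinom p x e * (a - 1) ^ e) ∧
    (∀ n : ℕ, (∑' e : ℕ, padicBinom p (n : ℤ_[p]) e * (a - 1) ^ e) = a ^ n) := by
  have hp1 : (p : ℝ)⁻¹ < 1 := inv_lt_one_of_one_lt₀ (mod_cast (Fact.out : p.Prime).one_lt)
  have hlim : Filter.Tendsto (fun e : ℕ => (a - 1) ^ e) Filter.atTop (nhds 0) :=
    tendsto_pow_atTop_nhds_zero_of_norm_lt_one (ha.trans_lt hp1)
  have hterm : ∀ (x : ℤ_[p]) (e : ℕ),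
      padicBinom p x e * (a - 1) ^ e = mahler e x • (a - 1) ^ e := fun x e => by
    rw [padicBinom_eq_mahler]
    rfl
  have hsum : ∀ x : ℤ_[p], Summable fun e : ℕ => padicBinom p x e * (a - 1) ^ e := fun x => by
    refine NonarchimedeanAddGroup.summable_of_tendsto_cofinite_zero ?_
    rw [Nat.cofinite_eq_atTop]
    refine squeeze_zero_norm (fun e => ?_) (tendsto_zero_iff_norm_tendsto_zero.mp hlim)
    rw [padicBinom_eq_mahler, norm_mul]
    exact mul_le_of_le_one_left (norm_nonneg _) (PadicInt.norm_le_one _)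
  have heq : ∀ x : ℤ_[p], (∑' e : ℕ, padicBinom p x e * (a - 1) ^ e) =
      PadicInt.mahlerSeries (fun e : ℕ => (a - 1) ^ e) x := fun x => by
    simp only [hterm, PadicInt.mahlerSeries_apply hlim]
  refine ⟨hsum, fun x => ?_, ?_, fun n => ?_⟩
  · have hzero : padicBinom p x 0 * (a - 1) ^ 0 = 1 := by simp [padicBinom]
    rw [(hsum x).tsum_eq_zero_add, hzero, add_sub_cancel_left]
    refine IsUltrametricDist.norm_tsum_le_of_forall_le_of_nonneg (by positivity) fun e => ?_
    rw [padicBinom_eq_mahler, norm_mul, norm_pow, pow_succ]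
    calc ‖((mahler (e + 1) x : ℤ_[p]) : ℚ_[p])‖ * (‖a - 1‖ ^ e * ‖a - 1‖)
        ≤ 1 * (1 * (p : ℝ)⁻¹) := by
          gcongr
          · exact PadicInt.norm_le_one _
          · exact pow_le_one₀ (norm_nonneg _) (ha.trans hp1.le)
      _ = (p : ℝ)⁻¹ := by ring
  · simpa only [heq] using (PadicInt.mahlerSeries (p := p) fun e : ℕ => (a - 1) ^ e).continuous
  · rw [heq, PadicInt.mahlerSeries_apply_nat hlim le_rfl]
    conv_rhs => rw [← sub_add_cancel a 1, add_pow]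
    simp [mul_comm]
end

section
/- Let p be a prime number, set q = 4 and m = 2 if p = 2, and q = p and m = 1 otherwise. Then for every natural number e, the rational number q^e/e! lies in p^{⌈(m − 1/(p−1))·e⌉} ℤ_p; equivalently, |q^e/e!| ≤ p^{−⌈(m − 1/(p−1))·e⌉} in ℚ_p. -/
theorem Padic.norm_natCast_factorial (p : ℕ) [Fact p.Prime] (n : ℕ) :
    ‖(n.factorial : ℚ_[p])‖ = (p : ℝ) ^ (-(padicValNat p n.factorial : ℤ)) := by
  rw [Padic.norm_eq_zpow_neg_valuation (mod_cast n.factorial_ne_zero), Padic.valuation_natCast]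

theorem padicValNat_factorial_le_div (p : ℕ) [hp : Fact p.Prime] (n : ℕ) :
    (padicValNat p n.factorial : ℝ) ≤ 1 / ((p : ℝ) - 1) * n := by
  have hp1 : (1 : ℝ) < p := mod_cast hp.out.one_lt
  have legendre : (p - 1) * padicValNat p n.factorial ≤ n :=
    (sub_one_mul_padicValNat_factorial n).trans_le (Nat.sub_le _ _)
  rw [one_div_mul_eq_div, le_div_iff₀' (sub_pos.2 hp1)]
  simpa [Nat.cast_sub hp.out.one_le] using (Nat.cast_le (α := ℝ)).2 legendre

/-- Let `p` be a prime, and set `q = 4, m = 2` if `p = 2` and `q = p, m = 1` otherwise.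
For every `e : ℕ` the rational number `q^e/e!` lies in `p^{⌈(m − 1/(p−1))·e⌉} ℤ_p`,
i.e. `|q^e/e!| ≤ p^{−⌈(m − 1/(p−1))·e⌉}` in `ℚ_p`. -/
theorem padic_exp_coefficient_valuation
    (p : ℕ) [Fact p.Prime] (e : ℕ) :
    ‖(((if p = 2 then 4 else p : ℕ)) : ℚ_[p]) ^ e / (e.factorial : ℚ_[p])‖ ≤
      (p : ℝ) ^ (-(⌈((((if p = 2 then 2 else 1 : ℕ)) : ℝ) - 1 / ((p : ℝ) - 1)) * e⌉)) := by
  have hp : p.Prime := Fact.out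
  have hq : (if p = 2 then 4 else p) = p ^ (if p = 2 then 2 else 1) := by
    split_ifs with h <;> simp [h]
  rw [hq]
  generalize (if p = 2 then 2 else 1) = m
  have hceil : ⌈((m : ℝ) - 1 / ((p : ℝ) - 1)) * e⌉ ≤ (m * e : ℤ) - padicValNat p e.factorial := by
    rw [Int.ceil_le]
    simp only [Int.cast_sub, Int.cast_mul, Int.cast_natCast]
    linarith [padicValNat_factorial_le_div p e]
  rw [Nat.cast_pow, ← pow_mul, norm_div, Padic.norm_p_pow, Padic.norm_natCast_factorial,
    ← zpow_sub₀ (mod_cast hp.ne_zero)]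
  refine zpow_le_zpow_right₀ (mod_cast hp.one_le) ?_
  rw [Nat.cast_mul]
  linarith
end

section
/- Let p be a prime number and set q = 4 if p = 2 and q = p otherwise. For every x ∈ qℤ_p one has exp_p(x) ∈ 1 + qℤ_p and log_p(exp_p(x)) = x; and for every y ∈ 1 + qℤ_p one has log_p(y) ∈ qℤ_p and exp_p(log_p(y)) = y. Thus exp_p and log_p are mutually inverse bijections between qℤ_p and 1 + qℤ_p. -/
/-- The `p`-adic exponential: the sum of the series `Σ_{e=0}^{∞} x^e / e!`
(convergent for `x ∈ qℤ_p`, where `q = 4` if `p = 2` and `q = p` otherwise). -/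
noncomputable def padicExp (p : ℕ) [Fact p.Prime] (x : ℚ_[p]) : ℚ_[p] :=
  ∑' e : ℕ, x ^ e / (e.factorial : ℚ_[p])

/-- The Iwasawa logarithm on `1 + pℤ_p`: the sum of the convergent series
`Σ_{e=1}^{∞} −(1−x)^e/e`. -/
noncomputable def padicLog (p : ℕ) [Fact p.Prime] (x : ℚ_[p]) : ℚ_[p] :=
  ∑' e : ℕ, -(1 - x) ^ (e + 1) / ((e : ℚ_[p]) + 1)

/-- The convergence bound behind both series: on `qℤ_p` the terms decay geometrically. -/
theorem padic_norm_pow_div_factorial_le (p : ℕ) [hp : Fact p.Prime] {x : ℚ_[p]}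
    (hx : ‖x‖ ≤ ‖((if p = 2 then 4 else p : ℕ) : ℚ_[p])‖) (k : ℕ) :
    ‖x ^ k / ((k + 1).factorial : ℚ_[p])‖ ≤ √((p : ℝ)⁻¹) ^ k := by
  set P : ℝ := (p : ℝ)⁻¹ with hP
  have hp1 : (1 : ℝ) < p := mod_cast hp.out.one_lt
  have hP0 : 0 < P := by positivity
  have hP1 : P ≤ 1 := inv_le_one_of_one_le₀ hp1.le
  set v := padicValNat p (k + 1).factorial with hv
  have hfac : ‖((k + 1).factorial : ℚ_[p])‖ = P ^ v := by
    rw [Padic.norm_eq_zpow_neg_valuation (mod_cast (k + 1).factorial_ne_zero),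
      Padic.valuation_natCast, zpow_neg, zpow_natCast, hP, inv_pow]
  have hval : (p - 1) * v ≤ k :=
    Nat.lt_succ_iff.mp (sub_one_mul_padicValNat_factorial_lt_of_ne_zero p k.succ_ne_zero)
  obtain ⟨c, hc, hck⟩ : ∃ c : ℕ, ‖((if p = 2 then 4 else p : ℕ) : ℚ_[p])‖ = P ^ c ∧
      2 * v + k ≤ 2 * (c * k) := by
    by_cases h2 : p = 2
    · refine ⟨2, ?_, ?_⟩
      · have hq : (if p = 2 then 4 else p) = p ^ 2 := by simp [h2]
        rw [hq, Nat.cast_pow, norm_pow, Padic.norm_p]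
      · have : p - 1 = 1 := by omega
        rw [this] at hval
        omega
    · refine ⟨1, by rw [if_neg h2, pow_one, Padic.norm_p], ?_⟩
      have : 2 ≤ p - 1 := by have := hp.out.two_le; omega
      nlinarith
  rw [hc] at hx
  refine le_of_sq_le_sq ?_ (by positivity)
  rw [← pow_mul, mul_comm k, pow_mul, Real.sq_sqrt hP0.le, norm_div, norm_pow, hfac, div_pow,
    div_le_iff₀ (by positivity)]
  calc (‖x‖ ^ k) ^ 2 ≤ ((P ^ c) ^ k) ^ 2 := by gcongr
    _ = P ^ (2 * (c * k)) := by ring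
    _ ≤ P ^ (2 * v + k) := pow_le_pow_of_le_one hP0.le hP1 hck
    _ = P ^ k * (P ^ v) ^ 2 := by ring

theorem sqrt_inv_prime_lt_one (p : ℕ) [hp : Fact p.Prime] : √((p : ℝ)⁻¹) < 1 := by
  rw [Real.sqrt_lt' one_pos, one_pow]
  exact inv_lt_one_of_one_lt₀ (mod_cast hp.out.one_lt)

theorem padic_norm_pow_succ_div_factorial_le (p : ℕ) [Fact p.Prime] {x : ℚ_[p]}
    (hx : ‖x‖ ≤ ‖((if p = 2 then 4 else p : ℕ) : ℚ_[p])‖) (k : ℕ) :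
    ‖x ^ (k + 1) / ((k + 1).factorial : ℚ_[p])‖ ≤ ‖x‖ * √((p : ℝ)⁻¹) ^ k := by
  rw [pow_succ', mul_div_assoc, norm_mul]
  gcongr
  exact padic_norm_pow_div_factorial_le p hx k

theorem padic_norm_pow_succ_div_le (p : ℕ) [Fact p.Prime] {x : ℚ_[p]}
    (hx : ‖x‖ ≤ ‖((if p = 2 then 4 else p : ℕ) : ℚ_[p])‖) (k : ℕ) :
    ‖x ^ (k + 1) / ((k : ℚ_[p]) + 1)‖ ≤ ‖x‖ * √((p : ℝ)⁻¹) ^ k := by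
  have hk : (k.factorial : ℚ_[p]) ≠ 0 := mod_cast k.factorial_ne_zero
  have hk1 : (k : ℚ_[p]) + 1 ≠ 0 := mod_cast k.succ_ne_zero
  have h : x ^ (k + 1) / ((k : ℚ_[p]) + 1) =
      x ^ (k + 1) / ((k + 1).factorial : ℚ_[p]) * k.factorial := by
    rw [Nat.factorial_succ]
    push_cast
    field_simp
  rw [h, norm_mul]
  have h1 : ‖(k.factorial : ℚ_[p])‖ ≤ 1 := mod_cast Padic.norm_int_le_one (p := p) k.factorial
  exact (mul_le_of_le_one_right (norm_nonneg _) h1).trans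
    (padic_norm_pow_succ_div_factorial_le p hx k)

theorem summable_mul_sqrt_inv_prime_pow (p : ℕ) [Fact p.Prime] (a : ℝ) :
    Summable fun k : ℕ => a * √((p : ℝ)⁻¹) ^ k :=
  (summable_geometric_of_lt_one (Real.sqrt_nonneg _) (sqrt_inv_prime_lt_one p)).mul_left a

theorem summable_norm_padicExp (p : ℕ) [Fact p.Prime] {x : ℚ_[p]}
    (hx : ‖x‖ ≤ ‖((if p = 2 then 4 else p : ℕ) : ℚ_[p])‖) :
    Summable fun e : ℕ => ‖x ^ e / (e.factorial : ℚ_[p])‖ :=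
  (summable_nat_add_iff 1).mp <| Summable.of_nonneg_of_le (fun _ => norm_nonneg _)
    (padic_norm_pow_succ_div_factorial_le p hx) (summable_mul_sqrt_inv_prime_pow p _)

theorem padicExp_sub_one (p : ℕ) [Fact p.Prime] {x : ℚ_[p]}
    (hx : ‖x‖ ≤ ‖((if p = 2 then 4 else p : ℕ) : ℚ_[p])‖) :
    padicExp p x - 1 = ∑' e : ℕ, x ^ (e + 1) / ((e + 1).factorial : ℚ_[p]) := by
  rw [padicExp, (summable_norm_padicExp p hx).of_norm.tsum_eq_zero_add]
  simp

theorem padicLog_one_add (p : ℕ) [Fact p.Prime] (t : ℚ_[p]) :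
    padicLog p (1 + t) = ∑' k : ℕ, (-1) ^ k * (t ^ (k + 1) / ((k : ℚ_[p]) + 1)) := by
  refine tsum_congr fun k => ?_
  rw [sub_add_cancel_left, neg_pow t, pow_succ (-1 : ℚ_[p])]
  ring

theorem norm_padicExp_sub_one_le (p : ℕ) [Fact p.Prime] {x : ℚ_[p]}
    (hx : ‖x‖ ≤ ‖((if p = 2 then 4 else p : ℕ) : ℚ_[p])‖) :
    ‖padicExp p x - 1‖ ≤ ‖x‖ := by
  rw [padicExp_sub_one p hx]
  refine IsUltrametricDist.norm_tsum_le_of_forall_le_of_nonneg (norm_nonneg _) fun k => ?_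
  exact (padic_norm_pow_succ_div_factorial_le p hx k).trans <|
    mul_le_of_le_one_right (norm_nonneg _)
      (pow_le_one₀ (Real.sqrt_nonneg _) (sqrt_inv_prime_lt_one p).le)

theorem norm_padicLog_le (p : ℕ) [Fact p.Prime] {t : ℚ_[p]}
    (ht : ‖t‖ ≤ ‖((if p = 2 then 4 else p : ℕ) : ℚ_[p])‖) :
    ‖padicLog p (1 + t)‖ ≤ ‖t‖ := by
  rw [padicLog_one_add]
  refine IsUltrametricDist.norm_tsum_le_of_forall_le_of_nonneg (norm_nonneg _) fun k => ?_
  rw [norm_mul, norm_pow, norm_neg, norm_one, one_pow, one_mul]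
  exact (padic_norm_pow_succ_div_le p ht k).trans <|
    mul_le_of_le_one_right (norm_nonneg _)
      (pow_le_one₀ (Real.sqrt_nonneg _) (sqrt_inv_prime_lt_one p).le)

/-- `log_p` has trivial kernel on `1 + qℤ_p`, since its linear term dominates. -/
theorem eq_zero_of_padicLog_one_add_eq_zero (p : ℕ) [Fact p.Prime] {t : ℚ_[p]}
    (ht : ‖t‖ ≤ ‖((if p = 2 then 4 else p : ℕ) : ℚ_[p])‖) (h : padicLog p (1 + t) = 0) :
    t = 0 := by
  have hs : Summable fun k : ℕ => (-1) ^ k * (t ^ (k + 1) / ((k : ℚ_[p]) + 1)) := by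
    refine Summable.of_norm_bounded (summable_mul_sqrt_inv_prime_pow p ‖t‖) fun k => ?_
    simpa [norm_mul] using padic_norm_pow_succ_div_le p ht k
  rw [padicLog_one_add, hs.tsum_eq_zero_add] at h
  have htail : ‖∑' k : ℕ, (-1) ^ (k + 1) * (t ^ (k + 1 + 1) / (((k + 1 : ℕ) : ℚ_[p]) + 1))‖
      ≤ ‖t‖ * √((p : ℝ)⁻¹) := by
    refine IsUltrametricDist.norm_tsum_le_of_forall_le_of_nonneg (by positivity) fun k => ?_
    rw [norm_mul, norm_pow, norm_neg, norm_one, one_pow, one_mul]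
    refine (padic_norm_pow_succ_div_le p ht (k + 1)).trans ?_
    gcongr
    exact pow_le_of_le_one (Real.sqrt_nonneg _) (sqrt_inv_prime_lt_one p).le k.succ_ne_zero
  have hlin : t = -∑' k : ℕ, (-1) ^ (k + 1) * (t ^ (k + 1 + 1) / (((k + 1 : ℕ) : ℚ_[p]) + 1)) := by
    rw [eq_neg_iff_add_eq_zero]
    simpa using h
  have hle : ‖t‖ ≤ ‖t‖ * √((p : ℝ)⁻¹) := by
    rw [← norm_neg, ← hlin] at htail
    exact htail
  have hlt := sqrt_inv_prime_lt_one p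
  exact norm_le_zero_iff.mp (by nlinarith [norm_nonneg t])

theorem padicExp_add (p : ℕ) [Fact p.Prime] {x y : ℚ_[p]}
    (hx : ‖x‖ ≤ ‖((if p = 2 then 4 else p : ℕ) : ℚ_[p])‖)
    (hy : ‖y‖ ≤ ‖((if p = 2 then 4 else p : ℕ) : ℚ_[p])‖) :
    padicExp p (x + y) = padicExp p x * padicExp p y := by
  rw [padicExp, padicExp, padicExp, tsum_mul_tsum_eq_tsum_sum_antidiagonal_of_summable_norm
    (summable_norm_padicExp p hx) (summable_norm_padicExp p hy)]
  refine tsum_congr fun n => ?_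
  rw [(Commute.all x y).add_pow', Finset.sum_div]
  refine Finset.sum_congr rfl fun ij hij => ?_
  have hij' := Finset.HasAntidiagonal.mem_antidiagonal.mp hij
  have h0 (m : ℕ) : (m.factorial : ℚ_[p]) ≠ 0 := mod_cast m.factorial_ne_zero
  have h1 := h0 ij.1
  have h2 := h0 ij.2
  have h3 := h0 n
  rw [nsmul_eq_mul, ← hij', Nat.cast_add_choose]
  rw [hij']
  field_simp

theorem padicExp_nat_mul (p : ℕ) [Fact p.Prime] {x : ℚ_[p]}
    (hx : ‖x‖ ≤ ‖((if p = 2 then 4 else p : ℕ) : ℚ_[p])‖) (N : ℕ) :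
    padicExp p (N * x) = padicExp p x ^ N := by
  induction N with
  | zero =>
    rw [Nat.cast_zero, zero_mul, pow_zero, padicExp, tsum_eq_single 0]
    · simp
    · intro e he
      simp [he]
  | succ N ih =>
    have hN : ‖(N : ℚ_[p])‖ ≤ 1 := mod_cast Padic.norm_int_le_one (p := p) N
    have hNx : ‖(N : ℚ_[p]) * x‖ ≤ ‖((if p = 2 then 4 else p : ℕ) : ℚ_[p])‖ := by
      rw [norm_mul]
      exact (mul_le_of_le_one_left (norm_nonneg _) hN).trans hx
    rw [Nat.cast_succ, add_mul, one_mul, padicExp_add p hNx hx, ih, pow_succ]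

open Filter Topology in
theorem tendsto_padic_prime_pow (p : ℕ) [Fact p.Prime] :
    Tendsto (fun n : ℕ => (p : ℚ_[p]) ^ n) atTop (𝓝 0) :=
  tendsto_pow_atTop_nhds_zero_of_norm_lt_one Padic.norm_p_lt_one

open Filter Topology in
/-- The derivative of `exp_p` at `0`, along the sequence `p ^ n`. -/
theorem tendsto_padicExp_pow_sub_one_div (p : ℕ) [hp : Fact p.Prime] {x : ℚ_[p]}
    (hx : ‖x‖ ≤ ‖((if p = 2 then 4 else p : ℕ) : ℚ_[p])‖) :
    Tendsto (fun n : ℕ => (padicExp p x ^ p ^ n - 1) / (p : ℚ_[p]) ^ n) atTop (𝓝 x) := by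
  have hp0 : (p : ℚ_[p]) ≠ 0 := mod_cast hp.out.ne_zero
  have hpn (n : ℕ) : ‖(p : ℚ_[p]) ^ n‖ ≤ 1 := by
    rw [norm_pow]
    exact pow_le_one₀ (norm_nonneg _) Padic.norm_p_lt_one.le
  have hterm (n : ℕ) : (padicExp p x ^ p ^ n - 1) / (p : ℚ_[p]) ^ n =
      ∑' k : ℕ, ((p : ℚ_[p]) ^ n) ^ k * (x ^ (k + 1) / ((k + 1).factorial : ℚ_[p])) := by
    have hnx : ‖((p ^ n : ℕ) : ℚ_[p]) * x‖ ≤ ‖((if p = 2 then 4 else p : ℕ) : ℚ_[p])‖ := by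
      rw [norm_mul, Nat.cast_pow]
      exact (mul_le_of_le_one_left (norm_nonneg _) (hpn n)).trans hx
    rw [← padicExp_nat_mul p hx, padicExp_sub_one p hnx, ← tsum_div_const]
    refine tsum_congr fun k => ?_
    rw [Nat.cast_pow, mul_pow, pow_succ ((p : ℚ_[p]) ^ n)]
    field_simp
  have hlim : x = ∑' k : ℕ, (0 : ℚ_[p]) ^ k * (x ^ (k + 1) / ((k + 1).factorial : ℚ_[p])) := by
    rw [tsum_eq_single 0]
    · simp
    · intro k hk
      simp [hk]
  simp_rw [hterm]
  nth_rw 2 [hlim]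
  refine tendsto_tsum_of_dominated_convergence (summable_mul_sqrt_inv_prime_pow p ‖x‖)
    (fun k => ((tendsto_padic_prime_pow p).pow k).mul_const _) (Eventually.of_forall fun n k => ?_)
  rw [norm_mul, norm_pow]
  exact (mul_le_of_le_one_left (norm_nonneg _) (pow_le_one₀ (norm_nonneg _) (hpn n))).trans
    (padic_norm_pow_succ_div_factorial_le p hx k)

open Filter Topology in
theorem tendsto_padic_choose_prime_pow_sub_one (p : ℕ) [hp : Fact p.Prime] (k : ℕ) :
    Tendsto (fun n : ℕ => ((p ^ n - 1).choose k : ℚ_[p])) atTop (𝓝 ((-1) ^ k)) := by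
  induction k with
  | zero => simp
  | succ k ih =>
    have hk : (k : ℚ_[p]) + 1 ≠ 0 := mod_cast k.succ_ne_zero
    have hrec (n : ℕ) : ((p ^ n - 1).choose (k + 1) : ℚ_[p]) =
        (p : ℚ_[p]) ^ n * ((p ^ n - 1).choose k : ℚ_[p]) / ((k : ℚ_[p]) + 1) -
          ((p ^ n - 1).choose k : ℚ_[p]) := by
      obtain ⟨M, hM⟩ := Nat.exists_eq_succ_of_ne_zero (pow_ne_zero n hp.out.ne_zero)
      have h1 : ((M + 1 : ℕ) : ℚ_[p]) * M.choose k = (M + 1).choose (k + 1) * (k + 1) :=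
        mod_cast Nat.add_one_mul_choose_eq M k
      have h2 : ((M + 1).choose (k + 1) : ℚ_[p]) = M.choose k + M.choose (k + 1) :=
        mod_cast Nat.choose_succ_succ M k
      rw [← Nat.cast_pow, hM, Nat.succ_sub_one, Nat.succ_eq_add_one, h1, h2]
      field_simp
      ring
    simp_rw [hrec]
    have := (((tendsto_padic_prime_pow p).mul ih).div_const ((k : ℚ_[p]) + 1)).sub ih
    simpa [pow_succ] using this

open Filter Topology in
/-- The `p`-adic logarithm as a limit of difference quotients of powers. -/
theorem tendsto_pow_sub_one_div_padicLog (p : ℕ) [hp : Fact p.Prime] {t : ℚ_[p]}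
    (ht : ‖t‖ ≤ ‖((if p = 2 then 4 else p : ℕ) : ℚ_[p])‖) :
    Tendsto (fun n : ℕ => ((1 + t) ^ p ^ n - 1) / (p : ℚ_[p]) ^ n) atTop
      (𝓝 (padicLog p (1 + t))) := by
  have hterm (n : ℕ) : ((1 + t) ^ p ^ n - 1) / (p : ℚ_[p]) ^ n =
      ∑' k : ℕ, ((p ^ n - 1).choose k : ℚ_[p]) * (t ^ (k + 1) / ((k : ℚ_[p]) + 1)) := by
    obtain ⟨M, hM⟩ := Nat.exists_eq_succ_of_ne_zero (pow_ne_zero n hp.out.ne_zero)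
    rw [← Nat.cast_pow, hM, Nat.succ_sub_one, Nat.succ_eq_add_one,
      tsum_eq_sum (s := Finset.range (M + 1)), add_comm 1 t, add_pow, Finset.sum_range_succ']
    · have hM0 : ((M + 1 : ℕ) : ℚ_[p]) ≠ 0 := mod_cast M.succ_ne_zero
      simp only [one_pow, mul_one, pow_zero, Nat.choose_zero_right, Nat.cast_one,
        add_sub_cancel_right]
      rw [Finset.sum_div]
      refine Finset.sum_congr rfl fun k _ => ?_
      have hk : (k : ℚ_[p]) + 1 ≠ 0 := mod_cast k.succ_ne_zero
      have h1 : ((M + 1 : ℕ) : ℚ_[p]) * M.choose k = (M + 1).choose (k + 1) * (k + 1) :=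
        mod_cast Nat.add_one_mul_choose_eq M k
      rw [mul_div_assoc', div_eq_div_iff hM0 hk]
      linear_combination -t ^ (k + 1) * h1
    · intro k hk
      rw [Nat.choose_eq_zero_of_lt (by simpa using hk), Nat.cast_zero, zero_mul]
  rw [padicLog_one_add]
  simp_rw [hterm]
  refine tendsto_tsum_of_dominated_convergence (summable_mul_sqrt_inv_prime_pow p ‖t‖)
    (fun k => (tendsto_padic_choose_prime_pow_sub_one p k).mul_const _)
    (Eventually.of_forall fun n k => ?_)
  rw [norm_mul]
  exact (mul_le_of_le_one_left (norm_nonneg _)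
    (mod_cast Padic.norm_int_le_one (p := p) ((p ^ n - 1).choose k))).trans
    (padic_norm_pow_succ_div_le p ht k)

theorem padicLog_padicExp (p : ℕ) [Fact p.Prime] {x : ℚ_[p]}
    (hx : ‖x‖ ≤ ‖((if p = 2 then 4 else p : ℕ) : ℚ_[p])‖) :
    padicLog p (padicExp p x) = x := by
  have h := tendsto_pow_sub_one_div_padicLog p ((norm_padicExp_sub_one_le p hx).trans hx)
  rw [add_sub_cancel] at h
  exact tendsto_nhds_unique h (tendsto_padicExp_pow_sub_one_div p hx)

open Filter Topology in
theorem padicLog_mul (p : ℕ) [hp : Fact p.Prime] {y z : ℚ_[p]}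
    (hy : ‖y - 1‖ ≤ ‖((if p = 2 then 4 else p : ℕ) : ℚ_[p])‖)
    (hz : ‖z - 1‖ ≤ ‖((if p = 2 then 4 else p : ℕ) : ℚ_[p])‖)
    (hyz : ‖y * z - 1‖ ≤ ‖((if p = 2 then 4 else p : ℕ) : ℚ_[p])‖) :
    padicLog p (y * z) = padicLog p y + padicLog p z := by
  have hp0 : (p : ℚ_[p]) ≠ 0 := mod_cast hp.out.ne_zero
  have key {w : ℚ_[p]} (hw : ‖w - 1‖ ≤ ‖((if p = 2 then 4 else p : ℕ) : ℚ_[p])‖) :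
      Tendsto (fun n : ℕ => (w ^ p ^ n - 1) / (p : ℚ_[p]) ^ n) atTop (𝓝 (padicLog p w)) := by
    simpa using tendsto_pow_sub_one_div_padicLog p hw
  have hz1 : Tendsto (fun n : ℕ => z ^ p ^ n) atTop (𝓝 1) := by
    have := ((tendsto_padic_prime_pow p).mul (key hz)).add_const 1
    rw [zero_mul, zero_add] at this
    refine this.congr fun n => ?_
    field_simp
    ring
  have hsum := ((key hy).mul hz1).add (key hz)
  rw [mul_one] at hsum
  refine tendsto_nhds_unique (key hyz) (hsum.congr fun n => ?_)
  rw [mul_pow]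
  ring

theorem norm_padic_q_lt_one (p : ℕ) [hp : Fact p.Prime] :
    ‖((if p = 2 then 4 else p : ℕ) : ℚ_[p])‖ < 1 := by
  rw [Padic.norm_natCast_lt_one_iff]
  split_ifs with h
  · rw [h]
    norm_num
  · exact dvd_rfl

theorem eq_of_padicLog_eq (p : ℕ) [Fact p.Prime] {y z : ℚ_[p]}
    (hy : ‖y - 1‖ ≤ ‖((if p = 2 then 4 else p : ℕ) : ℚ_[p])‖)
    (hz : ‖z - 1‖ ≤ ‖((if p = 2 then 4 else p : ℕ) : ℚ_[p])‖)
    (h : padicLog p y = padicLog p z) : y = z := by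
  have hz1 : ‖z‖ = 1 := by
    have := IsUltrametricDist.norm_add_eq_max_of_norm_ne_norm (x := z - 1) (y := (1 : ℚ_[p]))
      (by rw [norm_one]; exact (hz.trans_lt (norm_padic_q_lt_one p)).ne)
    rw [sub_add_cancel, norm_one] at this
    rw [this, max_eq_right (hz.trans (norm_padic_q_lt_one p).le)]
  have hz0 : z ≠ 0 := by
    rintro rfl
    simp at hz1
  have hu : ‖y / z - 1‖ ≤ ‖((if p = 2 then 4 else p : ℕ) : ℚ_[p])‖ := by
    rw [div_sub_one hz0, norm_div, hz1, div_one, ← sub_sub_sub_cancel_right y z 1,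
      sub_eq_add_neg (y - 1)]
    exact (IsUltrametricDist.norm_add_le_max _ _).trans (max_le hy (by rwa [norm_neg]))
  have hmul := padicLog_mul p hu hz (by rwa [div_mul_cancel₀ _ hz0])
  rw [div_mul_cancel₀ _ hz0, h, right_eq_add] at hmul
  have h1 := eq_zero_of_padicLog_one_add_eq_zero p hu (by rwa [add_sub_cancel])
  exact (div_eq_one_iff_eq hz0).mp (sub_eq_zero.mp h1)

/-- Let `p` be a prime and `q = 4` if `p = 2`, `q = p` otherwise.  For every `x ∈ qℤ_p`
one has `exp_p(x) ∈ 1 + qℤ_p` and `log_p(exp_p(x)) = x`; for every `y ∈ 1 + qℤ_p` one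
has `log_p(y) ∈ qℤ_p` and `exp_p(log_p(y)) = y`.  Thus `exp_p` and `log_p` are mutually
inverse bijections between `qℤ_p` and `1 + qℤ_p`. -/
theorem padic_exp_log_inverse
    (p : ℕ) [Fact p.Prime] :
    (∀ x : ℚ_[p], ‖x‖ ≤ ‖(((if p = 2 then 4 else p : ℕ)) : ℚ_[p])‖ →
      ‖padicExp p x - 1‖ ≤ ‖(((if p = 2 then 4 else p : ℕ)) : ℚ_[p])‖ ∧
        padicLog p (padicExp p x) = x) ∧
    (∀ y : ℚ_[p], ‖y - 1‖ ≤ ‖(((if p = 2 then 4 else p : ℕ)) : ℚ_[p])‖ →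
      ‖padicLog p y‖ ≤ ‖(((if p = 2 then 4 else p : ℕ)) : ℚ_[p])‖ ∧
        padicExp p (padicLog p y) = y) := by
  refine ⟨fun x hx => ⟨(norm_padicExp_sub_one_le p hx).trans hx, padicLog_padicExp p hx⟩,
    fun y hy => ?_⟩
  have hlog : ‖padicLog p y‖ ≤ ‖((if p = 2 then 4 else p : ℕ) : ℚ_[p])‖ := by
    have := norm_padicLog_le p hy
    rw [add_sub_cancel] at this
    exact this.trans hy
  exact ⟨hlog, eq_of_padicLog_eq p ((norm_padicExp_sub_one_le p hlog).trans hlog) hy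
    (padicLog_padicExp p hlog)⟩
end

section
/- Let p be a prime number and set q = 4 if p = 2 and q = p otherwise. (1) For every a ∈ 1 + qℤ_p and every x ∈ ℤ_p, a^x = exp_p(x · log_p(a)), where log_p(a) ∈ qℤ_p; in particular log_p(a^x) = x · log_p(a). (2) If p = 2, a ∈ −1 + 4ℤ_2, and x ∈ 1 + 2ℤ_2, then a^x = −exp_2(x · log_2(−a)). -/
/-- `a^z` for `a ∈ 1 + pℤ_p` and `z ∈ ℤ_p`: the sum of the convergent Mahler series
`Σ_{e=0}^{∞} C(z,e)·(a−1)^e`. -/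
noncomputable def padicPow (p : ℕ) [Fact p.Prime] (a : ℚ_[p]) (z : ℤ_[p]) : ℚ_[p] :=
  ∑' e : ℕ, padicBinom p z e * (a - 1) ^ e

open Filter Topology

section PadicExpLog

variable {p : ℕ} [Fact p.Prime]

/-- The square root of `|q|`, where `q = 4` if `p = 2` and `q = p` otherwise. It is the ratio of a
geometric series dominating the exponential and logarithm series on `qℤ_p`. -/
noncomputable def sqrtNormQ (p : ℕ) [Fact p.Prime] : ℝ :=
  √‖(((if p = 2 then 4 else p : ℕ)) : ℚ_[p])‖

lemma sqrtNormQ_sq :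
    sqrtNormQ p ^ 2 = ‖(((if p = 2 then 4 else p : ℕ)) : ℚ_[p])‖ :=
  Real.sq_sqrt (norm_nonneg _)

lemma sqrtNormQ_nonneg : 0 ≤ sqrtNormQ p := Real.sqrt_nonneg _

lemma exists_sqrtNormQ_sq_eq :
    ∃ w : ℕ, 0 < w ∧ (∀ e v : ℕ, (p - 1) * v ≤ e → 2 * v ≤ w * e) ∧
      sqrtNormQ p ^ 2 = ((p : ℝ) ^ w)⁻¹ := by
  have hp := (Fact.out : p.Prime)
  rw [sqrtNormQ_sq]
  split_ifs with h
  · subst h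
    refine ⟨2, two_pos, fun e v h ↦ by omega, ?_⟩
    have : ((4 : ℕ) : ℚ_[2]) = ((2 : ℕ) : ℚ_[2]) ^ 2 := by norm_num
    rw [this, norm_pow, Padic.norm_p, inv_pow]
  · refine ⟨1, one_pos, fun e v hv ↦ ?_, by rw [Padic.norm_p, pow_one]⟩
    have h3 : 2 ≤ p - 1 := by have := hp.two_le; omega
    nlinarith [Nat.mul_le_mul_right v h3]

lemma sqrtNormQ_lt_one : sqrtNormQ p < 1 := by
  obtain ⟨w, hw, -, h⟩ := exists_sqrtNormQ_sq_eq (p := p)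
  have hp : (1 : ℝ) < p := mod_cast (Fact.out : p.Prime).one_lt
  have : sqrtNormQ p ^ 2 < 1 := h ▸ inv_lt_one_of_one_lt₀ (one_lt_pow₀ hp hw.ne')
  exact (sq_lt_one_iff₀ sqrtNormQ_nonneg).1 this

lemma sqrtNormQ_pow_le_norm_factorial (e : ℕ) :
    sqrtNormQ p ^ e ≤ ‖((e + 1).factorial : ℚ_[p])‖ := by
  obtain ⟨w, -, hw, h⟩ := exists_sqrtNormQ_sq_eq (p := p)
  have hp : (1 : ℝ) ≤ p := mod_cast (Fact.out : p.Prime).one_lt.le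
  have hv := hw e (padicValNat p (e + 1).factorial) (Nat.lt_succ_iff.1
    (sub_one_mul_padicValNat_factorial_lt_of_ne_zero p e.succ_ne_zero))
  rw [Padic.norm_eq_zpow_neg_valuation (mod_cast (e + 1).factorial_ne_zero),
    Padic.valuation_natCast, zpow_neg, zpow_natCast]
  refine (sq_le_sq₀ (pow_nonneg sqrtNormQ_nonneg e) (by positivity)).1 ?_
  rw [← pow_mul, mul_comm e, pow_mul, h, inv_pow, ← pow_mul, inv_pow, ← pow_mul]
  exact inv_anti₀ (by positivity) (pow_le_pow_right₀ hp (by linarith))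

lemma norm_pow_div_le {u d : ℚ_[p]} {e : ℕ} (hu : ‖u‖ ≤ sqrtNormQ p ^ 2)
    (hd : ‖((e + 1).factorial : ℚ_[p])‖ ≤ ‖d‖) :
    ‖u ^ (e + 1) / d‖ ≤ ‖u‖ * sqrtNormQ p ^ e := by
  have hd' := (sqrtNormQ_pow_le_norm_factorial e).trans hd
  have hpos : 0 < ‖d‖ :=
    (norm_pos_iff.2 (Nat.cast_ne_zero.2 (e + 1).factorial_ne_zero)).trans_le hd
  rw [norm_div, norm_pow, div_le_iff₀ hpos, pow_succ', mul_assoc]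
  gcongr
  calc ‖u‖ ^ e ≤ (sqrtNormQ p ^ 2) ^ e := by gcongr
    _ = sqrtNormQ p ^ e * sqrtNormQ p ^ e := by ring
    _ ≤ sqrtNormQ p ^ e * ‖d‖ := by gcongr; exact pow_nonneg sqrtNormQ_nonneg e

lemma norm_factorial_le_norm_succ (e : ℕ) :
    ‖((e + 1).factorial : ℚ_[p])‖ ≤ ‖(e : ℚ_[p]) + 1‖ := by
  rw [Nat.factorial_succ, Nat.cast_mul, norm_mul, Nat.cast_succ]
  exact mul_le_of_le_one_right (norm_nonneg _)
    (by simpa using Padic.norm_int_le_one (p := p) (e.factorial : ℤ))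

lemma summable_mul_sqrtNormQ_pow (c : ℝ) : Summable fun e : ℕ ↦ c * sqrtNormQ p ^ e :=
  (summable_geometric_of_lt_one sqrtNormQ_nonneg sqrtNormQ_lt_one).mul_left c

lemma norm_tsum_le_of_forall {f : ℕ → ℚ_[p]} {c : ℝ} (h : ∀ e, ‖f e‖ ≤ c) :
    ‖∑' e, f e‖ ≤ c :=
  (IsUltrametricDist.norm_tsum_le f).trans (ciSup_le h)

/-! ### The power function as a continuous character -/

lemma continuous_padicBinom (e : ℕ) : Continuous fun x ↦ padicBinom p x e := by
  unfold padicBinom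
  have : Continuous fun x : ℤ_[p] ↦ (x : ℚ_[p]) := continuous_subtype_val
  fun_prop

lemma padicBinom_natCast (n e : ℕ) : padicBinom p n e = n.choose e := by
  rw [padicBinom, div_eq_iff (mod_cast e.factorial_ne_zero), ← Nat.cast_mul, mul_comm,
    ← Nat.descFactorial_eq_factorial_mul_choose, ← descPochhammer_eval_eq_descFactorial,
    descPochhammer_eval_eq_prod_range]
  simp

lemma padicBinom_neg_one (e : ℕ) : padicBinom p (-1) e = (-1) ^ e := by
  rw [padicBinom, div_eq_iff (mod_cast e.factorial_ne_zero), ← Finset.prod_range_add_one_eq_factorial,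
    Nat.cast_prod, ← Finset.card_range e, ← Finset.prod_const, Finset.card_range,
    ← Finset.prod_mul_distrib]
  refine Finset.prod_congr rfl fun i _ ↦ ?_
  push_cast
  ring

lemma padicBinom_eq_choose (x : ℤ_[p]) (e : ℕ) : padicBinom p x e = (Ring.choose x e : ℤ_[p]) := by
  refine congr_fun (PadicInt.denseRange_natCast.equalizer (continuous_padicBinom e)
    (continuous_subtype_val.comp (PadicInt.continuous_choose e)) (funext fun n ↦ ?_)) x
  change padicBinom p n e = (Ring.choose (n : ℤ_[p]) e : ℤ_[p])
  rw [padicBinom_natCast, Ring.choose_natCast, PadicInt.coe_natCast]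

instance : IsBoundedSMul ℤ_[p] ℚ_[p] :=
  .of_norm_smul_le fun x y ↦ (norm_mul (x : ℚ_[p]) y).le

lemma padicPow_eq_addChar {a : ℚ_[p]} (ha : Tendsto ((a - 1) ^ ·) atTop (𝓝 0)) (x : ℤ_[p]) :
    padicPow p a x = PadicInt.addChar_of_value_at_one (a - 1) ha x := by
  rw [PadicInt.coe_addChar_of_value_at_one, PadicInt.mahlerSeries_apply ha, padicPow]
  refine tsum_congr fun e ↦ ?_
  rw [padicBinom_eq_choose, mahler_apply]
  rfl

lemma tendsto_sub_one_pow {a : ℚ_[p]} (ha : ‖a - 1‖ < 1) :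
    Tendsto ((a - 1) ^ ·) atTop (𝓝 0) :=
  tendsto_pow_atTop_nhds_zero_iff_norm_lt_one.mpr ha

lemma norm_lt_one_of_le_sqrtNormQ_sq {u : ℚ_[p]} (hu : ‖u‖ ≤ sqrtNormQ p ^ 2) : ‖u‖ < 1 :=
  hu.trans_lt (pow_lt_one₀ sqrtNormQ_nonneg sqrtNormQ_lt_one two_ne_zero)

/-! ### The logarithm -/

lemma norm_padicLog_term_le {a : ℚ_[p]} (ha : ‖a - 1‖ ≤ sqrtNormQ p ^ 2) (e : ℕ) :
    ‖-(1 - a) ^ (e + 1) / ((e : ℚ_[p]) + 1)‖ ≤ ‖a - 1‖ * sqrtNormQ p ^ e := by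
  rw [neg_div, norm_neg, norm_sub_rev a]
  exact norm_pow_div_le (by rwa [norm_sub_rev]) (norm_factorial_le_norm_succ e)

lemma norm_padicLog_le_s18 {a : ℚ_[p]} (ha : ‖a - 1‖ ≤ sqrtNormQ p ^ 2) :
    ‖padicLog p a‖ ≤ ‖a - 1‖ :=
  norm_tsum_le_of_forall fun e ↦ (norm_padicLog_term_le ha e).trans
    (mul_le_of_le_one_right (norm_nonneg _) (pow_le_one₀ sqrtNormQ_nonneg sqrtNormQ_lt_one.le))

lemma eq_one_of_padicLog_eq_zero {a : ℚ_[p]} (ha : ‖a - 1‖ ≤ sqrtNormQ p ^ 2)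
    (h : padicLog p a = 0) : a = 1 := by
  have hsum := Summable.of_norm_bounded (summable_mul_sqrtNormQ_pow _) (norm_padicLog_term_le ha)
  rw [padicLog, hsum.tsum_eq_zero_add] at h
  have hle : ‖a - 1‖ ≤ ‖a - 1‖ * sqrtNormQ p := by
    have h1 : a - 1 = -∑' e : ℕ, -(1 - a) ^ (e + 1 + 1) / (((e + 1 : ℕ) : ℚ_[p]) + 1) := by
      rw [← eq_neg_iff_add_eq_zero] at h
      rw [← h]
      simp
    conv_lhs => rw [h1, norm_neg]
    refine norm_tsum_le_of_forall fun e ↦ (norm_padicLog_term_le ha (e + 1)).trans ?_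
    gcongr
    exact pow_le_of_le_one sqrtNormQ_nonneg sqrtNormQ_lt_one.le e.succ_ne_zero
  have : ‖a - 1‖ = 0 := by
    nlinarith [norm_nonneg (a - 1), sqrtNormQ_lt_one (p := p)]
  exact sub_eq_zero.1 (norm_eq_zero.1 this)

lemma pow_sub_one_div_eq_tsum (a : ℚ_[p]) (n : ℕ) :
    (a ^ (n + 1) - 1) / ((n + 1 : ℕ) : ℚ_[p]) =
      ∑' e : ℕ, padicBinom p n e * ((a - 1) ^ (e + 1) / ((e : ℚ_[p]) + 1)) := by
  have hn : ((n + 1 : ℕ) : ℚ_[p]) ≠ 0 := mod_cast n.succ_ne_zero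
  rw [tsum_eq_sum (s := Finset.range (n + 1)), div_eq_iff hn, Finset.sum_mul]
  · nth_rw 1 [← sub_add_cancel a 1]
    rw [add_pow, Finset.sum_range_succ', add_sub_assoc]
    simp only [one_pow, mul_one, pow_zero, Nat.choose_zero_right, Nat.cast_one, sub_self, add_zero]
    refine Finset.sum_congr rfl fun e _ ↦ ?_
    have he : (e : ℚ_[p]) + 1 ≠ 0 := mod_cast e.succ_ne_zero
    have h := congrArg (Nat.cast : ℕ → ℚ_[p]) (Nat.add_one_mul_choose_eq n e)
    push_cast at h
    rw [padicBinom_natCast]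
    field_simp
    push_cast
    linear_combination (-(a - 1) ^ (e + 1)) * h
  · intro e he
    rw [padicBinom_natCast, Nat.choose_eq_zero_of_lt (by simpa using he), Nat.cast_zero, zero_mul]

lemma tendsto_prime_pow : Tendsto (fun n : ℕ ↦ ((p ^ n : ℕ) : ℚ_[p])) atTop (𝓝 0) := by
  simp only [Nat.cast_pow]
  exact tendsto_pow_atTop_nhds_zero_iff_norm_lt_one.mpr Padic.norm_p_lt_one

lemma tendsto_prime_pow_padicInt :
    Tendsto (fun n : ℕ ↦ ((p ^ n : ℕ) : ℤ_[p])) atTop (𝓝 0) :=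
  tendsto_subtype_rng.2 (by simpa using tendsto_prime_pow (p := p))

lemma tendsto_padicLog {a : ℚ_[p]} (ha : ‖a - 1‖ ≤ sqrtNormQ p ^ 2) :
    Tendsto (fun n : ℕ ↦ (a ^ (p ^ n) - 1) / ((p ^ n : ℕ) : ℚ_[p])) atTop (𝓝 (padicLog p a)) := by
  have hpos (n : ℕ) : p ^ n - 1 + 1 = p ^ n :=
    Nat.sub_add_cancel (Nat.pow_pos (Fact.out : p.Prime).pos)
  have hlim : Tendsto (fun n : ℕ ↦ ((p ^ n - 1 : ℕ) : ℤ_[p])) atTop (𝓝 (-1)) := by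
    have := (tendsto_prime_pow_padicInt (p := p)).sub_const 1
    rw [zero_sub] at this
    refine this.congr fun n ↦ ?_
    rw [sub_eq_iff_eq_add]
    exact_mod_cast (hpos n).symm
  have key : Tendsto (fun n : ℕ ↦ ∑' e : ℕ, padicBinom p ((p ^ n - 1 : ℕ) : ℤ_[p]) e *
      ((a - 1) ^ (e + 1) / ((e : ℚ_[p]) + 1))) atTop (𝓝 (padicLog p a)) := by
    refine tendsto_tsum_of_dominated_convergence (summable_mul_sqrtNormQ_pow (p := p) ‖a - 1‖)
      (fun e ↦ ?_) (.of_forall fun n e ↦ ?_)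
    · have h := ((continuous_padicBinom e).tendsto _).comp hlim
      rw [padicBinom_neg_one] at h
      have hterm : -(1 - a) ^ (e + 1) / ((e : ℚ_[p]) + 1) =
          (-1) ^ e * ((a - 1) ^ (e + 1) / ((e : ℚ_[p]) + 1)) := by
        rw [← neg_sub a 1, neg_pow]
        ring
      rw [hterm]
      exact h.mul_const _
    · rw [norm_mul, padicBinom_eq_choose]
      exact (mul_le_of_le_one_left (norm_nonneg _) (PadicInt.norm_le_one _)).trans
        (norm_pow_div_le ha (norm_factorial_le_norm_succ e))
  refine key.congr fun n ↦ ?_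
  rw [← pow_sub_one_div_eq_tsum, hpos]

lemma padicLog_mul_s18 {a b : ℚ_[p]} (ha : ‖a - 1‖ ≤ sqrtNormQ p ^ 2) (hb : ‖b - 1‖ ≤ sqrtNormQ p ^ 2)
    (hab : ‖a * b - 1‖ ≤ sqrtNormQ p ^ 2) :
    padicLog p (a * b) = padicLog p a + padicLog p b := by
  have hp (n : ℕ) : ((p ^ n : ℕ) : ℚ_[p]) ≠ 0 :=
    mod_cast pow_ne_zero n (Fact.out : p.Prime).ne_zero
  have hone : Tendsto (fun n : ℕ ↦ a ^ (p ^ n)) atTop (𝓝 1) := by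
    have := ((tendsto_prime_pow (p := p)).mul (tendsto_padicLog ha)).const_add 1
    rw [zero_mul, add_zero] at this
    refine this.congr fun n ↦ ?_
    rw [mul_div_cancel₀ _ (hp n)]
    ring
  have h := (tendsto_padicLog ha).add (hone.mul (tendsto_padicLog hb))
  rw [one_mul] at h
  refine tendsto_nhds_unique (tendsto_padicLog hab) (h.congr fun n ↦ ?_)
  rw [mul_pow]
  ring

/-! ### The exponential -/

lemma norm_padicExp_term_le {y : ℚ_[p]} (hy : ‖y‖ ≤ sqrtNormQ p ^ 2) (e : ℕ) :
    ‖y ^ (e + 1) / ((e + 1).factorial : ℚ_[p])‖ ≤ ‖y‖ * sqrtNormQ p ^ e :=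
  norm_pow_div_le hy le_rfl

lemma summable_norm_padicExp_s18 {y : ℚ_[p]} (hy : ‖y‖ ≤ sqrtNormQ p ^ 2) :
    Summable fun e : ℕ ↦ ‖y ^ e / (e.factorial : ℚ_[p])‖ :=
  (summable_nat_add_iff 1).1 <| Summable.of_nonneg_of_le (fun _ ↦ norm_nonneg _)
    (norm_padicExp_term_le hy) (summable_mul_sqrtNormQ_pow _)

lemma padicExp_eq_one_add {y : ℚ_[p]} (hy : ‖y‖ ≤ sqrtNormQ p ^ 2) :
    padicExp p y = 1 + ∑' e : ℕ, y ^ (e + 1) / ((e + 1).factorial : ℚ_[p]) := by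
  rw [padicExp, (summable_norm_padicExp_s18 hy).of_norm.tsum_eq_zero_add]
  simp

lemma norm_padicExp_sub_one_le_s18 {y : ℚ_[p]} (hy : ‖y‖ ≤ sqrtNormQ p ^ 2) :
    ‖padicExp p y - 1‖ ≤ ‖y‖ := by
  rw [padicExp_eq_one_add hy, add_sub_cancel_left]
  exact norm_tsum_le_of_forall fun e ↦ (norm_padicExp_term_le hy e).trans
    (mul_le_of_le_one_right (norm_nonneg _) (pow_le_one₀ sqrtNormQ_nonneg sqrtNormQ_lt_one.le))

lemma padicExp_zero : padicExp p 0 = 1 := by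
  rw [padicExp_eq_one_add (by simp [sq_nonneg])]
  simp

lemma padicExp_add_s18 {y z : ℚ_[p]} (hy : ‖y‖ ≤ sqrtNormQ p ^ 2) (hz : ‖z‖ ≤ sqrtNormQ p ^ 2) :
    padicExp p (y + z) = padicExp p y * padicExp p z := by
  rw [padicExp, padicExp, padicExp, tsum_mul_tsum_eq_tsum_sum_antidiagonal_of_summable_norm
    (summable_norm_padicExp_s18 hy) (summable_norm_padicExp_s18 hz)]
  refine tsum_congr fun n ↦ ?_
  rw [(Commute.all y z).add_pow', Finset.sum_div]
  refine Finset.sum_congr rfl fun kl hkl ↦ ?_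
  rw [Finset.HasAntidiagonal.mem_antidiagonal] at hkl
  have hn : (n.factorial : ℚ_[p]) ≠ 0 := mod_cast n.factorial_ne_zero
  have h1 : (kl.1.factorial : ℚ_[p]) ≠ 0 := mod_cast kl.1.factorial_ne_zero
  have h2 : (kl.2.factorial : ℚ_[p]) ≠ 0 := mod_cast kl.2.factorial_ne_zero
  have h := congrArg (Nat.cast : ℕ → ℚ_[p]) (Nat.add_choose_mul_factorial_mul_factorial kl.1 kl.2)
  rw [hkl] at h
  push_cast at h
  rw [nsmul_eq_mul, Nat.choose_symm_of_eq_add hkl.symm]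
  field_simp
  linear_combination y ^ kl.1 * z ^ kl.2 * h

lemma norm_coe_mul_le (x : ℤ_[p]) {y : ℚ_[p]} (hy : ‖y‖ ≤ sqrtNormQ p ^ 2) :
    ‖(x : ℚ_[p]) * y‖ ≤ sqrtNormQ p ^ 2 := by
  rw [norm_mul]
  exact (mul_le_of_le_one_left (norm_nonneg y) (PadicInt.norm_le_one x)).trans hy

/-- The character `x ↦ exp_p(x * y)` of `ℤ_p`, for `y ∈ qℤ_p`. -/
noncomputable def padicExpChar (y : ℚ_[p]) (hy : ‖y‖ ≤ sqrtNormQ p ^ 2) :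
    AddChar ℤ_[p] ℚ_[p] where
  toFun x := padicExp p ((x : ℚ_[p]) * y)
  map_zero_eq_one' := by simp [padicExp_zero]
  map_add_eq_mul' x z := by
    rw [PadicInt.coe_add, add_mul, padicExp_add_s18 (norm_coe_mul_le x hy) (norm_coe_mul_le z hy)]

lemma padicExpChar_apply {y : ℚ_[p]} (hy : ‖y‖ ≤ sqrtNormQ p ^ 2) (x : ℤ_[p]) :
    padicExpChar y hy x = padicExp p ((x : ℚ_[p]) * y) := rfl

lemma continuous_padicExpChar {y : ℚ_[p]} (hy : ‖y‖ ≤ sqrtNormQ p ^ 2) :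
    Continuous (padicExpChar y hy) := by
  have h : Continuous fun x : ℤ_[p] ↦ padicExp p ((x : ℚ_[p]) * y) := by
    refine continuous_tsum (fun e ↦ ?_) (summable_norm_padicExp_s18 hy) fun e x ↦ ?_
    · have : Continuous fun x : ℤ_[p] ↦ (x : ℚ_[p]) := continuous_subtype_val
      fun_prop
    · rw [norm_div, norm_div, norm_pow, norm_pow, norm_mul]
      gcongr
      exact mul_le_of_le_one_left (norm_nonneg y) (PadicInt.norm_le_one x)
  exact h

lemma padicLog_padicExp_s18 {y : ℚ_[p]} (hy : ‖y‖ ≤ sqrtNormQ p ^ 2) :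
    padicLog p (padicExp p y) = y := by
  have hexp := (norm_padicExp_sub_one_le_s18 hy).trans hy
  have hp (n : ℕ) : ((p ^ n : ℕ) : ℚ_[p]) ≠ 0 :=
    mod_cast pow_ne_zero n (Fact.out : p.Prime).ne_zero
  have hpow (n : ℕ) : padicExp p y ^ n = padicExp p (n * y) := by
    have := (padicExpChar y hy).map_nsmul_eq_pow n 1
    simpa [padicExpChar_apply] using this.symm
  have key : Tendsto (fun n : ℕ ↦ ∑' e : ℕ, ((p ^ n : ℕ) : ℚ_[p]) ^ e *
      (y ^ (e + 1) / ((e + 1).factorial : ℚ_[p]))) atTop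
      (𝓝 (∑' e : ℕ, (0 : ℚ_[p]) ^ e * (y ^ (e + 1) / ((e + 1).factorial : ℚ_[p])))) := by
    refine tendsto_tsum_of_dominated_convergence (summable_mul_sqrtNormQ_pow (p := p) ‖y‖)
      (fun e ↦ ((tendsto_prime_pow (p := p)).pow e).mul_const _) (.of_forall fun n e ↦ ?_)
    rw [norm_mul, norm_pow]
    refine (mul_le_of_le_one_left (norm_nonneg _) (pow_le_one₀ (norm_nonneg _) ?_)).trans
      (norm_padicExp_term_le hy e)
    simpa using Padic.norm_int_le_one (p := p) ((p ^ n : ℕ) : ℤ)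
  rw [tsum_eq_single 0 (fun e he ↦ by rw [zero_pow he, zero_mul])] at key
  simp only [pow_zero, zero_add, pow_one, Nat.factorial_one, Nat.cast_one, div_one, one_mul] at key
  refine tendsto_nhds_unique (tendsto_padicLog hexp) (key.congr fun n ↦ ?_)
  have hy' := norm_coe_mul_le ((p ^ n : ℕ) : ℤ_[p]) hy
  rw [PadicInt.coe_natCast] at hy'
  rw [hpow, padicExp_eq_one_add hy', add_sub_cancel_left, ← tsum_div_const]
  refine tsum_congr fun e ↦ ?_
  have := hp n
  rw [mul_pow]
  field_simp
  ring

lemma padicExp_padicLog {a : ℚ_[p]} (ha : ‖a - 1‖ ≤ sqrtNormQ p ^ 2) :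
    padicExp p (padicLog p a) = a := by
  have hlog := (norm_padicLog_le_s18 ha).trans ha
  set b := padicExp p (padicLog p a) with hb
  have hb1 : ‖b - 1‖ ≤ sqrtNormQ p ^ 2 := (norm_padicExp_sub_one_le_s18 hlog).trans hlog
  have hnorm : ‖a‖ = 1 := by
    simpa using Padic.norm_eq_of_norm_sub_lt_right (z1 := a) (z2 := 1)
      (by simpa using norm_lt_one_of_le_sqrtNormQ_sq ha)
  have ha0 : a ≠ 0 := norm_ne_zero_iff.1 (hnorm ▸ one_ne_zero)
  have hc : ‖b / a - 1‖ ≤ sqrtNormQ p ^ 2 := by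
    rw [div_sub_one ha0, norm_div, hnorm, div_one, ← sub_sub_sub_cancel_right b a 1]
    rw [sub_eq_add_neg]
    refine (Padic.nonarchimedean _ _).trans (max_le hb1 (by rwa [norm_neg]))
  have hmul := padicLog_mul_s18 hc ha (by rwa [div_mul_cancel₀ _ ha0])
  rw [div_mul_cancel₀ _ ha0, hb, padicLog_padicExp_s18 hlog, ← hb, right_eq_add] at hmul
  exact (div_eq_one_iff_eq ha0).1 (eq_one_of_padicLog_eq_zero hc hmul)

/-! ### Comparison of the power function with the exponential -/

lemma padicPow_eq_padicExp {a : ℚ_[p]} (ha : ‖a - 1‖ ≤ sqrtNormQ p ^ 2) (x : ℤ_[p]) :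
    padicPow p a x = padicExp p ((x : ℚ_[p]) * padicLog p a) := by
  have hlog := (norm_padicLog_le_s18 ha).trans ha
  rw [padicPow_eq_addChar (tendsto_sub_one_pow (norm_lt_one_of_le_sqrtNormQ_sq ha)),
    ← PadicInt.eq_addChar_of_value_at_one _ (continuous_padicExpChar hlog), padicExpChar_apply]
  rw [padicExpChar_apply, PadicInt.coe_one, one_mul, padicExp_padicLog ha]
  ring

lemma padicPow_neg_of_dvd_sub_one {a : ℚ_[p]} (ha : ‖a - 1‖ < 1) (ha' : ‖-a - 1‖ < 1)
    {x : ℤ_[p]} (hx : 2 ∣ x - 1) : padicPow p a x = -padicPow p (-a) x := by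
  obtain ⟨t, ht⟩ := hx
  obtain rfl : x = 1 + (t + t) := by linear_combination ht
  rw [padicPow_eq_addChar (tendsto_sub_one_pow ha), padicPow_eq_addChar (tendsto_sub_one_pow ha')]
  set κ := PadicInt.addChar_of_value_at_one (p := p) (a - 1) (tendsto_sub_one_pow ha) with hκ
  set μ := PadicInt.addChar_of_value_at_one (p := p) (-a - 1) (tendsto_sub_one_pow ha') with hμ
  have hκ1 : κ 1 = a := by simp [hκ]
  have hμ1 : μ 1 = -a := by simp [hμ]
  have hκc : Continuous κ := PadicInt.continuous_addChar_of_value_at_one _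
  have hμc : Continuous μ := PadicInt.continuous_addChar_of_value_at_one _
  have h : κ * κ = μ * μ := by
    refine PadicInt.denseRange_natCast.addChar_eq_of_eval_one_eq ?_ ?_ ?_
    · exact hκc.mul hκc
    · exact hμc.mul hμc
    · rw [AddChar.mul_apply, AddChar.mul_apply, hκ1, hμ1, neg_mul_neg]
  have ht := DFunLike.congr_fun h t
  rw [AddChar.mul_apply, AddChar.mul_apply] at ht
  rw [AddChar.map_add_eq_mul κ, AddChar.map_add_eq_mul κ, AddChar.map_add_eq_mul μ,
    AddChar.map_add_eq_mul μ, hκ1, hμ1, ht, neg_mul, neg_neg]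

end PadicExpLog

/-- Let `p` be a prime and `q = 4` if `p = 2`, `q = p` otherwise.
(1) For every `a ∈ 1 + qℤ_p` and every `x ∈ ℤ_p`, `log_p(a) ∈ qℤ_p` and
`a^x = exp_p(x·log_p(a))`; in particular `log_p(a^x) = x·log_p(a)`.
(2) If `p = 2`, `a ∈ −1 + 4ℤ_2` and `x ∈ 1 + 2ℤ_2`, then
`a^x = −exp_2(x·log_2(−a))`. -/
theorem padic_pow_via_exp_log
    (p : ℕ) [Fact p.Prime] :
    (∀ a : ℚ_[p], ‖a - 1‖ ≤ ‖(((if p = 2 then 4 else p : ℕ)) : ℚ_[p])‖ →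
      ‖padicLog p a‖ ≤ ‖(((if p = 2 then 4 else p : ℕ)) : ℚ_[p])‖ ∧
      ∀ x : ℤ_[p],
        padicPow p a x = padicExp p ((x : ℚ_[p]) * padicLog p a) ∧
        padicLog p (padicPow p a x) = (x : ℚ_[p]) * padicLog p a) ∧
    (p = 2 → ∀ a : ℚ_[p], ‖a + 1‖ ≤ ‖(4 : ℚ_[p])‖ →
      ∀ x : ℤ_[p], (2 : ℤ_[p]) ∣ (x - 1) →
        padicPow p a x = -padicExp p ((x : ℚ_[p]) * padicLog p (-a))) := by
  refine ⟨fun a ha ↦ ?_, ?_⟩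
  · rw [← sqrtNormQ_sq] at ha ⊢
    have hlog := (norm_padicLog_le_s18 ha).trans ha
    refine ⟨hlog, fun x ↦ ⟨padicPow_eq_padicExp ha x, ?_⟩⟩
    rw [padicPow_eq_padicExp ha, padicLog_padicExp_s18 (norm_coe_mul_le x hlog)]
  · rintro rfl a ha x hx
    have hneg : ‖-a - 1‖ ≤ sqrtNormQ 2 ^ 2 := by
      rw [sqrtNormQ_sq, ← neg_add', norm_neg]
      simpa using ha
    have hlt := norm_lt_one_of_le_sqrtNormQ_sq hneg
    have htwo : ‖(2 : ℚ_[2])‖ < 1 := by simpa using Padic.norm_p_lt_one (p := 2)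
    have ha1 : ‖a - 1‖ < 1 := by
      rw [show a - 1 = -(-a - 1) + -2 by ring]
      exact (Padic.nonarchimedean _ _).trans_lt (max_lt (by rwa [norm_neg]) (by rwa [norm_neg]))
    rw [padicPow_neg_of_dvd_sub_one ha1 hlt hx, padicPow_eq_padicExp hneg]
end
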